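/- arXiv:2102.09976 — 2 statements merged into one kernel-verified Lean document; each statement's English description precedes it below -/
import Mathlib

section
/- Let Ω ⊆ ℝⁿ be open, and let v ∈ C¹(Ω;𝕂ⁿ) be a vector field satisfying ∂ⱼvₖ = ∂ₖvⱼ for all j,k = 1,…,n. Let γ, γ̃: [0,1] → Ω be C¹-paths with γ(0) = γ̃(0) =: x⁰, γ'(0) = γ̃'(0) = 0, γ(1) = γ̃(1) =: x¹, γ'(1) = γ̃'(1) = 0, and suppose there exists a continuous map Γ: [0,1]² → Ω with Γ(·,0) = γ, Γ(·,1) = γ̃, Γ(0,t) = x⁰ and Γ(1,t) = x¹ for all t ∈ [0,1] (a fixed-end-point homotopy). Then ∫₀¹ v(γ(s))·γ'(s) ds = ∫₀¹ v(γ̃(s))·γ̃'(s) ds. -/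
open MeasureTheory
open scoped BigOperators

noncomputable section

/-- Euclidean space `ℝⁿ`. -/
abbrev Euc (n : ℕ) := EuclideanSpace ℝ (Fin n)

section ClosedForms

open Set Metric

variable {E F : Type*} [NormedAddCommGroup E] [NormedSpace ℝ E]
  [NormedAddCommGroup F] [NormedSpace ℝ F]

/-- The integral of a `1`-form `ω` along a parametrized path, over the parameters `[a, b]`. -/
def pathIntegral (ω : E → E →L[ℝ] F) (γ : ℝ → E) (a b : ℝ) : F :=
  ∫ s in a..b, ω (γ s) (derivWithin γ (Icc 0 1) s)

/-- The integral of a `1`-form along the segment from `a` to `b`. -/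
def segmentIntegral (ω : E → E →L[ℝ] F) (a b : E) : F :=
  pathIntegral ω (AffineMap.lineMap a b) 0 1

theorem continuousOn_form_apply_derivWithin {ω : E → E →L[ℝ] F} {γ : ℝ → E} {s : Set ℝ}
    {U : Set E} (hω : ContinuousOn ω U) (hγ : ContDiffOn ℝ 1 γ (Icc 0 1))
    (hs : s ⊆ Icc 0 1) (hγU : MapsTo γ s U) :
    ContinuousOn (fun t => ω (γ t) (derivWithin γ (Icc 0 1) t)) s :=
  (hω.comp (hγ.continuousOn.mono hs) hγU).clm_apply
    ((hγ.continuousOn_derivWithin (uniqueDiffOn_Icc zero_lt_one) le_rfl).mono hs)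

/-- The integral of an exact form is the increment of its primitive. -/
theorem pathIntegral_eq_sub [CompleteSpace F] {ω : E → E →L[ℝ] F} {φ : E → F} {γ : ℝ → E}
    {U : Set E} {a b : ℝ} (hω : ContinuousOn ω U) (hφ : ∀ y ∈ U, HasFDerivAt φ (ω y) y)
    (hγ : ContDiffOn ℝ 1 γ (Icc 0 1)) (ha : 0 ≤ a) (hab : a ≤ b) (hb : b ≤ 1)
    (hγU : MapsTo γ (Icc a b) U) :
    pathIntegral ω γ a b = φ (γ b) - φ (γ a) := by
  have hsub : Icc a b ⊆ Icc 0 1 := Icc_subset_Icc ha hb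
  refine intervalIntegral.integral_eq_sub_of_hasDerivAt_of_le (f := φ ∘ γ) hab ?_ ?_ ?_
  · exact ContinuousOn.comp (fun y hy => (hφ y hy).continuousAt.continuousWithinAt)
      (hγ.continuousOn.mono hsub) hγU
  · intro t ht
    have hd := (hγ.differentiableOn one_ne_zero t
      (hsub (Ioo_subset_Icc_self ht))).hasDerivWithinAt.hasDerivAt
      (Icc_mem_nhds (ha.trans_lt ht.1) (ht.2.trans_le hb))
    exact (hφ _ (hγU (Ioo_subset_Icc_self ht))).comp_hasDerivAt t hd
  · exact (continuousOn_form_apply_derivWithin hω hγ hsub hγU).intervalIntegrable_of_Icc hab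

theorem segmentIntegral_eq_sub [CompleteSpace F] {ω : E → E →L[ℝ] F} {φ : E → F}
    {U : Set E} (hU : Convex ℝ U) (hω : ContinuousOn ω U)
    (hφ : ∀ y ∈ U, HasFDerivAt φ (ω y) y) {a b : E} (ha : a ∈ U) (hb : b ∈ U) :
    segmentIntegral ω a b = φ b - φ a := by
  have := pathIntegral_eq_sub (γ := AffineMap.lineMap a b) hω hφ
    (ContinuousAffineMap.lineMap (R := ℝ) a b).contDiff.contDiffOn le_rfl zero_le_one le_rfl
    (fun t ht => hU.lineMap_mem ha hb ht)
  simpa [segmentIntegral] using this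

@[simp]
theorem segmentIntegral_self (ω : E → E →L[ℝ] F) (a : E) : segmentIntegral ω a a = 0 := by
  simp [segmentIntegral, pathIntegral, AffineMap.lineMap_same]

/-- A locally exact form has primitives on balls of a uniform radius around a compact set. -/
theorem exists_primitive_ball_of_isCompact {ω : E → E →L[ℝ] F} {Ω K : Set E}
    (hΩ : IsOpen Ω)
    (hloc : ∀ x ∈ Ω, ∃ r > 0, ∃ φ : E → F, ∀ y ∈ ball x r, HasFDerivAt φ (ω y) y)
    (hK : IsCompact K) (hKΩ : K ⊆ Ω) :
    ∃ ε > 0, ∀ x ∈ K, ball x ε ⊆ Ω ∧ ∃ φ : E → F, ∀ y ∈ ball x ε, HasFDerivAt φ (ω y) y := by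
  choose! r hr φ hφ using hloc
  obtain ⟨ε, hε, h⟩ := lebesgue_number_lemma_of_metric (c := fun x : Ω => ball (x : E) (r x) ∩ Ω)
    hK (fun x => isOpen_ball.inter hΩ) fun x hx =>
      mem_iUnion.2 ⟨⟨x, hKΩ hx⟩, mem_ball_self (hr x (hKΩ hx)), hKΩ hx⟩
  refine ⟨ε, hε, fun x hx => ?_⟩
  obtain ⟨z, hz⟩ := h x hx
  exact ⟨fun y hy => (hz hy).2, φ z, fun y hy => hφ z z.2 y (hz hy).1⟩

theorem natCast_div_mem_Icc {N i : ℕ} (hi : i ≤ N) : (i : ℝ) / N ∈ Icc (0 : ℝ) 1 :=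
  ⟨by positivity, div_le_one_of_le₀ (by exact_mod_cast hi) (by positivity)⟩

/-- The integral of a form along a path equals its integral along an inscribed polygon, if each
piece of the path lies in a ball on which the form is exact. -/
theorem pathIntegral_eq_sum_segmentIntegral [CompleteSpace F] {ω : E → E →L[ℝ] F} {Ω : Set E}
    (hω : ContinuousOn ω Ω) {γ : ℝ → E} (hγ : ContDiffOn ℝ 1 γ (Icc 0 1))
    (hγΩ : MapsTo γ (Icc 0 1) Ω) {N : ℕ} (hN : 0 < N) {ε : ℝ} (hε : 0 < ε)
    (hball : ∀ s ∈ Icc (0 : ℝ) 1, ball (γ s) ε ⊆ Ω ∧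
      ∃ φ : E → F, ∀ y ∈ ball (γ s) ε, HasFDerivAt φ (ω y) y)
    (hclose : ∀ s ∈ Icc (0 : ℝ) 1, ∀ t ∈ Icc (0 : ℝ) 1, |s - t| ≤ 1 / N →
      dist (γ s) (γ t) < ε) :
    pathIntegral ω γ 0 1 =
      ∑ i ∈ Finset.range N, segmentIntegral ω (γ ((i : ℝ) / N)) (γ (((i + 1 : ℕ) : ℝ) / N)) := by
  have hN' : (0 : ℝ) < N := by exact_mod_cast hN
  have hle (i : ℕ) : (i : ℝ) / N ≤ ((i + 1 : ℕ) : ℝ) / N := by gcongr; simp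
  have hsum := intervalIntegral.sum_integral_adjacent_intervals (μ := volume) (n := N)
    (a := fun i : ℕ => (i : ℝ) / N)
    (f := fun s => ω (γ s) (derivWithin γ (Icc 0 1) s)) fun i hi =>
      (continuousOn_form_apply_derivWithin hω hγ subset_rfl hγΩ).mono
        (Icc_subset_Icc (natCast_div_mem_Icc hi.le).1 (natCast_div_mem_Icc hi).2)
        |>.intervalIntegrable_of_Icc (hle i)
  simp only [Nat.cast_zero, zero_div, div_self hN'.ne'] at hsum
  rw [pathIntegral, ← hsum]
  refine Finset.sum_congr rfl fun i hi => ?_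
  have hi' : i < N := Finset.mem_range.1 hi
  have h0 := natCast_div_mem_Icc hi'.le
  have h1 := natCast_div_mem_Icc (Nat.succ_le_of_lt hi')
  obtain ⟨hsub, φ, hφ⟩ := hball _ h0
  have hmaps : MapsTo γ (Icc ((i : ℝ) / N) (((i + 1 : ℕ) : ℝ) / N)) (ball (γ ((i : ℝ) / N)) ε) := by
    intro t ht
    refine hclose t ⟨h0.1.trans ht.1, ht.2.trans h1.2⟩ _ h0 ?_
    have h2 := ht.2
    rw [Nat.cast_succ, add_div] at h2
    rw [abs_of_nonneg (sub_nonneg.2 ht.1)]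
    linarith
  rw [segmentIntegral_eq_sub (convex_ball _ _) (hω.mono hsub) hφ (mem_ball_self hε)
    (hmaps (right_mem_Icc.2 (hle i)))]
  exact pathIntegral_eq_sub (hω.mono hsub) hφ hγ h0.1 (hle i) h1.2 hmaps

/-- The integrals of a locally exact form along two `C¹` paths joined by a continuous homotopy with
fixed end points agree. -/
theorem pathIntegral_eq_of_homotopy [CompleteSpace F] {ω : E → E →L[ℝ] F} {Ω : Set E}
    (hΩ : IsOpen Ω) (hω : ContinuousOn ω Ω)
    (hloc : ∀ x ∈ Ω, ∃ r > 0, ∃ φ : E → F, ∀ y ∈ ball x r, HasFDerivAt φ (ω y) y)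
    {γ₀ γ₁ : ℝ → E} (hγ₀ : ContDiffOn ℝ 1 γ₀ (Icc 0 1)) (hγ₁ : ContDiffOn ℝ 1 γ₁ (Icc 0 1))
    {x₀ x₁ : E} {H : ℝ × ℝ → E} (hH : ContinuousOn H (Icc 0 1 ×ˢ Icc 0 1))
    (hHΩ : MapsTo H (Icc 0 1 ×ˢ Icc 0 1) Ω)
    (hH₀ : ∀ s ∈ Icc (0 : ℝ) 1, H (s, 0) = γ₀ s) (hH₁ : ∀ s ∈ Icc (0 : ℝ) 1, H (s, 1) = γ₁ s)
    (hHl : ∀ t ∈ Icc (0 : ℝ) 1, H (0, t) = x₀) (hHr : ∀ t ∈ Icc (0 : ℝ) 1, H (1, t) = x₁) :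
    pathIntegral ω γ₀ 0 1 = pathIntegral ω γ₁ 0 1 := by
  have hcomp : IsCompact (Icc (0 : ℝ) 1 ×ˢ Icc (0 : ℝ) 1) := isCompact_Icc.prod isCompact_Icc
  obtain ⟨ε, hε, hball⟩ := exists_primitive_ball_of_isCompact hΩ hloc
    (hcomp.image_of_continuousOn hH) hHΩ.image_subset
  obtain ⟨δ, hδ, hunif⟩ :=
    Metric.uniformContinuousOn_iff.1 (hcomp.uniformContinuousOn_of_continuous hH) ε hε
  obtain ⟨m, hm⟩ := exists_nat_one_div_lt hδ
  obtain ⟨N, hN, hNδ⟩ : ∃ N : ℕ, 0 < N ∧ 1 / (N : ℝ) < δ :=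
    ⟨m + 1, m.succ_pos, by exact_mod_cast hm⟩
  have hN' : (N : ℝ) ≠ 0 := by exact_mod_cast hN.ne'
  have hclose {s t s' t' : ℝ} (hs : s ∈ Icc (0 : ℝ) 1) (ht : t ∈ Icc (0 : ℝ) 1)
      (hs' : s' ∈ Icc (0 : ℝ) 1) (ht' : t' ∈ Icc (0 : ℝ) 1)
      (h : |s - s'| ≤ 1 / N) (h' : |t - t'| ≤ 1 / N) : dist (H (s, t)) (H (s', t')) < ε :=
    hunif _ ⟨hs, ht⟩ _ ⟨hs', ht'⟩ ((max_le h h').trans_lt hNδ)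
  have hrow {γ : ℝ → E} (hγ : ContDiffOn ℝ 1 γ (Icc 0 1)) {t : ℝ} (ht : t ∈ Icc (0 : ℝ) 1)
      (hHγ : ∀ s ∈ Icc (0 : ℝ) 1, H (s, t) = γ s) : pathIntegral ω γ 0 1 =
        ∑ i ∈ Finset.range N, segmentIntegral ω (H ((i : ℝ) / N, t))
          (H (((i + 1 : ℕ) : ℝ) / N, t)) := by
    rw [pathIntegral_eq_sum_segmentIntegral hω hγ (fun s hs => hHγ s hs ▸ hHΩ ⟨hs, ht⟩) hN hε
      (fun s hs => hHγ s hs ▸ hball _ (mem_image_of_mem H ⟨hs, ht⟩))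
      (fun s hs s' hs' h => by
        rw [← hHγ s hs, ← hHγ s' hs']
        exact hclose hs ht hs' ht h (by simp))]
    refine Finset.sum_congr rfl fun i hi => ?_
    have hi' : i < N := Finset.mem_range.1 hi
    rw [hHγ _ (natCast_div_mem_Icc hi'.le), hHγ _ (natCast_div_mem_Icc hi')]
  set p : ℕ → ℕ → E := fun i k => H ((i : ℝ) / N, (k : ℝ) / N) with hp
  have hstep (i : ℕ) : |((i + 1 : ℕ) : ℝ) / N - (i : ℝ) / N| ≤ 1 / N := by
    rw [← sub_div, Nat.cast_succ, add_sub_cancel_left, abs_of_nonneg (by positivity)]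
  have hcell (i k : ℕ) (hi : i < N) (hk : k < N) :
      segmentIntegral ω (p i k) (p (i + 1) k) - segmentIntegral ω (p i (k + 1)) (p (i + 1) (k + 1)) =
        segmentIntegral ω (p i k) (p i (k + 1)) -
          segmentIntegral ω (p (i + 1) k) (p (i + 1) (k + 1)) := by
    have hi₀ := natCast_div_mem_Icc hi.le
    have hi₁ := natCast_div_mem_Icc (Nat.succ_le_of_lt hi)
    have hk₀ := natCast_div_mem_Icc hk.le
    have hk₁ := natCast_div_mem_Icc (Nat.succ_le_of_lt hk)
    obtain ⟨hsub, φ, hφ⟩ := hball (p i k) (mem_image_of_mem H ⟨hi₀, hk₀⟩)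
    have m₀₀ : p i k ∈ ball (p i k) ε := mem_ball_self hε
    have m₁₀ : p (i + 1) k ∈ ball (p i k) ε := hclose hi₁ hk₀ hi₀ hk₀ (hstep i) (by simp)
    have m₀₁ : p i (k + 1) ∈ ball (p i k) ε := hclose hi₀ hk₁ hi₀ hk₀ (by simp) (hstep k)
    have m₁₁ : p (i + 1) (k + 1) ∈ ball (p i k) ε :=
      hclose hi₁ hk₁ hi₀ hk₀ (hstep i) (hstep k)
    have key {a b : E} (ha : a ∈ ball (p i k) ε) (hb : b ∈ ball (p i k) ε) :
        segmentIntegral ω a b = φ b - φ a :=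
      segmentIntegral_eq_sub (convex_ball _ _) (hω.mono hsub) hφ ha hb
    rw [key m₀₀ m₁₀, key m₀₁ m₁₁, key m₀₀ m₀₁, key m₁₀ m₁₁]
    abel
  have hconst (k : ℕ) (hk : k ≤ N) :
      ∑ i ∈ Finset.range N, segmentIntegral ω (p i k) (p (i + 1) k) =
        ∑ i ∈ Finset.range N, segmentIntegral ω (p i 0) (p (i + 1) 0) := by
    induction k with
    | zero => rfl
    | succ k ih =>
      rw [← ih (Nat.le_of_succ_le hk), eq_comm, ← sub_eq_zero, ← Finset.sum_sub_distrib,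
        Finset.sum_congr rfl fun i hi => hcell i k (Finset.mem_range.1 hi) hk,
        Finset.sum_range_sub' (fun i => segmentIntegral ω (p i k) (p i (k + 1)))]
      have hk₀ := natCast_div_mem_Icc (Nat.le_of_succ_le hk)
      have hk₁ := natCast_div_mem_Icc hk
      simp only [hp, Nat.cast_zero, zero_div, div_self hN', hHl _ hk₀, hHl _ hk₁, hHr _ hk₀,
        hHr _ hk₁, segmentIntegral_self, sub_zero]
  rw [hrow hγ₀ (left_mem_Icc.2 zero_le_one) hH₀, hrow hγ₁ (right_mem_Icc.2 zero_le_one) hH₁]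
  simpa [hp, hN'] using (hconst N le_rfl).symm

end ClosedForms

/-- The linear form `h ↦ ∑ j, h j • w j` on `ℝⁿ`, as a function of the vector `w`. -/
def dotForm (n : ℕ) (𝕜 : Type*) [RCLike 𝕜] : (Fin n → 𝕜) →L[ℝ] Euc n →L[ℝ] 𝕜 :=
  ∑ j, (ContinuousLinearMap.smulRightL ℝ (Euc n) 𝕜 (EuclideanSpace.proj j)).comp
    (ContinuousLinearMap.proj j)

theorem dotForm_apply {n : ℕ} {𝕜 : Type*} [RCLike 𝕜] (w : Fin n → 𝕜) (h : Euc n) :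
    dotForm n 𝕜 w h = ∑ j, h j • w j := by
  simp [dotForm]

theorem fderiv_dotForm_comp_symm {n : ℕ} {𝕜 : Type*} [RCLike 𝕜] {v : Euc n → Fin n → 𝕜} {x : Euc n}
    (hv : DifferentiableAt ℝ v x)
    (hsymm : ∀ j k : Fin n,
      fderiv ℝ (fun y => v y k) x (EuclideanSpace.single j (1 : ℝ)) =
        fderiv ℝ (fun y => v y j) x (EuclideanSpace.single k (1 : ℝ))) (a b : Euc n) :
    fderiv ℝ (fun y => dotForm n 𝕜 (v y)) x a b = fderiv ℝ (fun y => dotForm n 𝕜 (v y)) x b a := by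
  have hcoord (j : Fin n) (h : Euc n) : fderiv ℝ (fun y => v y j) x h = fderiv ℝ v x h j := by
    rw [(hasFDerivAt_pi'.1 hv.hasFDerivAt j).fderiv]
    rfl
  have hd : fderiv ℝ (fun y => dotForm n 𝕜 (v y)) x = (dotForm n 𝕜).comp (fderiv ℝ v x) :=
    ((dotForm n 𝕜).hasFDerivAt.comp x hv.hasFDerivAt).fderiv
  have hexp (c : Euc n) : c = ∑ k, c k • EuclideanSpace.single k (1 : ℝ) := by
    ext i
    simp [Pi.single_apply]
  have hmain (c d : Euc n) : fderiv ℝ (fun y => dotForm n 𝕜 (v y)) x c d =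
      ∑ j, ∑ k, (d j * c k) • fderiv ℝ (fun y => v y j) x (EuclideanSpace.single k (1 : ℝ)) := by
    rw [hd, ContinuousLinearMap.comp_apply, dotForm_apply]
    refine Finset.sum_congr rfl fun j _ => ?_
    rw [← hcoord]
    conv_lhs => rw [hexp c]
    simp only [map_sum, map_smul, Finset.smul_sum, mul_smul]
  rw [hmain, hmain, Finset.sum_comm]
  refine Finset.sum_congr rfl fun j _ => Finset.sum_congr rfl fun k _ => ?_
  rw [hsymm, mul_comm]

/-- **Homotopy invariance of line integrals of curl-free fields.**
Let `Ω ⊆ ℝⁿ` be open, let `v ∈ C¹(Ω;𝕂ⁿ)` satisfy `∂ⱼvₖ = ∂ₖvⱼ` on `Ω`, and let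
`γ, γ̃ : [0,1] → Ω` be `C¹`-paths with common endpoints and vanishing endpoint
derivatives.  If there is a fixed-end-point homotopy `Γ : [0,1]² → Ω` between `γ` and
`γ̃`, then `∫_γ v = ∫_γ̃ v`. -/
theorem lineIntegral_eq_of_fep_homotopic {n : ℕ} {𝕜 : Type*} [RCLike 𝕜]
    (Ω : Set (Euc n)) (hΩ_open : IsOpen Ω)
    (v : Euc n → Fin n → 𝕜) (hv : ContDiffOn ℝ 1 v Ω)
    (hv_symm : ∀ x ∈ Ω, ∀ j k : Fin n,
      fderiv ℝ (fun y => v y k) x (EuclideanSpace.single j (1 : ℝ)) =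
        fderiv ℝ (fun y => v y j) x (EuclideanSpace.single k (1 : ℝ)))
    (γ γt : ℝ → Euc n)
    (hγ : ContDiffOn ℝ 1 γ (Set.Icc 0 1)) (hγt : ContDiffOn ℝ 1 γt (Set.Icc 0 1))
    (hγΩ : ∀ s ∈ Set.Icc (0 : ℝ) 1, γ s ∈ Ω)
    (hγtΩ : ∀ s ∈ Set.Icc (0 : ℝ) 1, γt s ∈ Ω)
    (h0 : γ 0 = γt 0) (h1 : γ 1 = γt 1)
    (hγ'0 : derivWithin γ (Set.Icc 0 1) 0 = 0)
    (hγ'1 : derivWithin γ (Set.Icc 0 1) 1 = 0)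
    (hγt'0 : derivWithin γt (Set.Icc 0 1) 0 = 0)
    (hγt'1 : derivWithin γt (Set.Icc 0 1) 1 = 0)
    (H : ℝ × ℝ → Euc n)
    (hH_cont : ContinuousOn H (Set.Icc 0 1 ×ˢ Set.Icc 0 1))
    (hHΩ : ∀ p ∈ Set.Icc (0 : ℝ) 1 ×ˢ Set.Icc (0 : ℝ) 1, H p ∈ Ω)
    (hH0 : ∀ s ∈ Set.Icc (0 : ℝ) 1, H (s, 0) = γ s)
    (hH1 : ∀ s ∈ Set.Icc (0 : ℝ) 1, H (s, 1) = γt s)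
    (hHl : ∀ t ∈ Set.Icc (0 : ℝ) 1, H (0, t) = γ 0)
    (hHr : ∀ t ∈ Set.Icc (0 : ℝ) 1, H (1, t) = γ 1) :
    ∫ s in (0 : ℝ)..1, ∑ j, (derivWithin γ (Set.Icc 0 1) s j) • v (γ s) j =
      ∫ s in (0 : ℝ)..1, ∑ j, (derivWithin γt (Set.Icc 0 1) s j) • v (γt s) j := by
  have hω : ContDiffOn ℝ 1 (fun y => dotForm n 𝕜 (v y)) Ω :=
    (dotForm n 𝕜).contDiff.comp_contDiffOn hv
  have hloc : ∀ x ∈ Ω, ∃ r > 0, ∃ φ : Euc n → 𝕜, ∀ y ∈ Metric.ball x r,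
      HasFDerivAt φ (dotForm n 𝕜 (v y)) y := by
    intro x hx
    obtain ⟨r, hr, hsub⟩ := Metric.isOpen_iff.1 hΩ_open x hx
    refine ⟨r, hr, (convex_ball x r).exists_forall_hasFDerivAt_of_fderiv_symmetric
      Metric.isOpen_ball ((hω.differentiableOn one_ne_zero).mono hsub) fun y hy => ?_⟩
    exact fderiv_dotForm_comp_symm
      ((hv.differentiableOn one_ne_zero).differentiableAt (hΩ_open.mem_nhds (hsub hy)))
      (hv_symm y (hsub hy))
  have := pathIntegral_eq_of_homotopy hΩ_open hω.continuousOn hloc hγ hγt hH_cont hHΩ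
    hH0 hH1 hHl hHr
  simpa only [pathIntegral, dotForm_apply] using this
end
end

section
/- Let Ω ⊆ ℝⁿ be open, let v ∈ C¹(Ω;𝕂ⁿ) satisfy ∂ⱼvₖ = ∂ₖvⱼ for all j,k = 1,…,n, and let Γ: [0,1]² → Ω be twice continuously differentiable with Γ(0,t) and Γ(1,t) independent of t ∈ [0,1]. Then ∫₀¹ v(Γ(s,0))·∂ₛΓ(s,0) ds = ∫₀¹ v(Γ(s,1))·∂ₛΓ(s,1) ds. -/
open MeasureTheory
open scoped BigOperators

noncomputable section

/-- The slice of a function continuous on the unit square, as a path. -/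
def slicePath {E : Type*} [TopologicalSpace E] (Γ : ℝ → ℝ → E)
    (h : ContinuousOn (fun p : ℝ × ℝ => Γ p.1 p.2) (Set.Icc 0 1 ×ˢ Set.Icc 0 1))
    (t : unitInterval) : Path (Γ 0 t) (Γ 1 t) where
  toFun s := Γ s t
  continuous_toFun := h.comp_continuous (f := fun s : unitInterval => ((s : ℝ), (t : ℝ)))
    (by fun_prop) fun s => ⟨s.2, t.2⟩
  source' := by simp
  target' := by simp

/-- A function continuous on the unit square, as a homotopy between its first and last slices. -/
def sliceHomotopy {E : Type*} [TopologicalSpace E] (Γ : ℝ → ℝ → E)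
    (h : ContinuousOn (fun p : ℝ × ℝ => Γ p.1 p.2) (Set.Icc 0 1 ×ˢ Set.Icc 0 1)) :
    (slicePath Γ h 0 : C(unitInterval, E)).Homotopy (slicePath Γ h 1) where
  toFun p := Γ p.2 p.1
  continuous_toFun := h.comp_continuous
    (f := fun p : unitInterval × unitInterval => ((p.2 : ℝ), (p.1 : ℝ)))
    (by fun_prop) fun p => ⟨p.2.2, p.1.2⟩
  map_zero_left _ := rfl
  map_one_left _ := rfl

/-- The `ℝ`-linear map sending coefficients `a` to the one-form `∑ k, a k dx_k`. -/
def oneForm (n : ℕ) (𝕜 : Type*) [RCLike 𝕜] : (Fin n → 𝕜) →L[ℝ] Euc n →L[ℝ] 𝕜 :=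
  ∑ k, (ContinuousLinearMap.smulRightL ℝ (Euc n) 𝕜 (EuclideanSpace.proj k)) ∘L
    ContinuousLinearMap.proj k

theorem oneForm_apply {n : ℕ} {𝕜 : Type*} [RCLike 𝕜] (a : Fin n → 𝕜) (w : Euc n) :
    oneForm n 𝕜 a w = ∑ k, w k • a k := by
  simp [oneForm]

theorem oneForm_fderiv_symm {n : ℕ} {𝕜 : Type*} [RCLike 𝕜] {v : Euc n → Fin n → 𝕜} {x : Euc n}
    (hv : DifferentiableAt ℝ v x)
    (hsymm : ∀ j k : Fin n,
      fderiv ℝ (fun y => v y k) x (EuclideanSpace.single j (1 : ℝ)) =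
        fderiv ℝ (fun y => v y j) x (EuclideanSpace.single k (1 : ℝ))) (u w : Euc n) :
    oneForm n 𝕜 (fderiv ℝ v x u) w = oneForm n 𝕜 (fderiv ℝ v x w) u := by
  have key (u : Euc n) (k : Fin n) : fderiv ℝ v x u k =
      ∑ j, u j • fderiv ℝ (fun y => v y k) x (EuclideanSpace.single j (1 : ℝ)) := by
    have h1 : fderiv ℝ v x u k = fderiv ℝ (fun y => v y k) x u := by
      rw [fderiv_apply hv k]; rfl
    have h2 : u = ∑ j, u j • EuclideanSpace.single j (1 : ℝ) := by
      ext i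
      simp [Finset.sum_apply, Pi.single_apply]
    rw [h1]
    conv_lhs => rw [h2]
    simp only [map_sum, map_smul]
  simp only [oneForm_apply, key, Finset.smul_sum]
  rw [Finset.sum_comm]
  refine Finset.sum_congr rfl fun j _ => Finset.sum_congr rfl fun k _ => ?_
  rw [hsymm j k, smul_comm]

theorem curveIntegral_oneForm_slicePath {n : ℕ} {𝕜 : Type*} [RCLike 𝕜] (v : Euc n → Fin n → 𝕜)
    (Γ : ℝ → ℝ → Euc n)
    (h : ContinuousOn (fun p : ℝ × ℝ => Γ p.1 p.2) (Set.Icc 0 1 ×ˢ Set.Icc 0 1))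
    (t : unitInterval) :
    curveIntegral (fun y => oneForm n 𝕜 (v y)) (slicePath Γ h t) = ∫ s in (0 : ℝ)..1,
      ∑ j, (derivWithin (fun u => Γ u t) (Set.Icc 0 1) s j) • v (Γ s t) j := by
  rw [curveIntegral_def]
  refine intervalIntegral.integral_congr fun s hs => ?_
  rw [Set.uIcc_of_le zero_le_one] at hs
  have hext : Set.EqOn (slicePath Γ h t).extend (fun u => Γ u t) (Set.Icc 0 1) := fun u hu => by
    rw [Path.extend_apply _ hu]; rfl
  simp only [curveIntegralFun_def]
  rw [derivWithin_congr hext (hext hs), hext hs, oneForm_apply]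

theorem curveIntegral_eq_zero_of_forall_eq {E F : Type*} [NormedAddCommGroup E] [NormedSpace ℝ E]
    [NormedAddCommGroup F] [NormedSpace ℝ F] {a b : E} (ω : E → E →L[ℝ] F) (γ : Path a b)
    (h : ∀ t, γ t = a) : curveIntegral ω γ = 0 := by
  have hab : b = a := by simpa using h 1
  subst hab
  have : γ = Path.refl b := by ext t; exact h t
  rw [this, curveIntegral_refl]

/-- **Smooth homotopy invariance of line integrals of curl-free fields.**
Let `Ω ⊆ ℝⁿ` be open, let `v ∈ C¹(Ω;𝕂ⁿ)` satisfy `∂ⱼvₖ = ∂ₖvⱼ` on `Ω`, and let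
`Γ : [0,1]² → Ω` be twice continuously differentiable with `Γ(0,·)` and `Γ(1,·)`
constant.  Then `∫₀¹ v(Γ(s,0))·∂ₛΓ(s,0) ds = ∫₀¹ v(Γ(s,1))·∂ₛΓ(s,1) ds`. -/
theorem lineIntegral_eq_of_smooth_homotopy {n : ℕ} {𝕜 : Type*} [RCLike 𝕜]
    (Ω : Set (Euc n)) (hΩ_open : IsOpen Ω)
    (v : Euc n → Fin n → 𝕜) (hv : ContDiffOn ℝ 1 v Ω)
    (hv_symm : ∀ x ∈ Ω, ∀ j k : Fin n,
      fderiv ℝ (fun y => v y k) x (EuclideanSpace.single j (1 : ℝ)) =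
        fderiv ℝ (fun y => v y j) x (EuclideanSpace.single k (1 : ℝ)))
    (Γ : ℝ → ℝ → Euc n)
    (hΓ : ContDiffOn ℝ 2 (fun p : ℝ × ℝ => Γ p.1 p.2) (Set.Icc 0 1 ×ˢ Set.Icc 0 1))
    (hΓΩ : ∀ s ∈ Set.Icc (0 : ℝ) 1, ∀ t ∈ Set.Icc (0 : ℝ) 1, Γ s t ∈ Ω)
    (hΓ0 : ∀ t ∈ Set.Icc (0 : ℝ) 1, Γ 0 t = Γ 0 0)
    (hΓ1 : ∀ t ∈ Set.Icc (0 : ℝ) 1, Γ 1 t = Γ 1 0) :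
    ∫ s in (0 : ℝ)..1,
        ∑ j, (derivWithin (fun u => Γ u 0) (Set.Icc 0 1) s j) • v (Γ s 0) j =
      ∫ s in (0 : ℝ)..1,
        ∑ j, (derivWithin (fun u => Γ u 1) (Set.Icc 0 1) s j) • v (Γ s 1) j := by
  have hΓc := hΓ.continuousOn
  set sq : Set (ℝ × ℝ) := Set.Icc 0 1 ×ˢ Set.Icc 0 1
  let φ := sliceHomotopy Γ hΓc
  set K : Set (Euc n) := (fun p : ℝ × ℝ => Γ p.1 p.2) '' sq
  have hKΩ : K ⊆ Ω := by
    rintro _ ⟨p, hp, rfl⟩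
    exact hΓΩ _ hp.1 _ hp.2
  have hK : IsClosed K := ((isCompact_Icc.prod isCompact_Icc).image_of_continuousOn hΓc).isClosed
  have hdiff (x : Euc n) (hx : x ∈ K) : DifferentiableAt ℝ v x :=
    (hv.contDiffAt (hΩ_open.mem_nhds (hKΩ hx))).differentiableAt one_ne_zero
  have hmain := φ.curveIntegral_add_curveIntegral_eq_of_hasFDerivWithinAt (t := K)
    (ω := fun y => oneForm n 𝕜 (v y)) (dω := fun x => oneForm n 𝕜 ∘L fderiv ℝ v x)
    (fun a _ b _ => ⟨(b, a), ⟨b.2, a.2⟩, rfl⟩)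
    (fun x hx => ((oneForm n 𝕜).hasFDerivAt.comp x (hdiff x hx).hasFDerivAt).hasFDerivWithinAt)
    (by
      rw [hK.closure_eq]
      exact (oneForm n 𝕜).continuous.comp_continuousOn (hv.continuousOn.mono hKΩ))
    (fun x hx u _ w _ => oneForm_fderiv_symm (hdiff x hx) (hv_symm x (hKΩ hx)) u w)
    (by
      rw [← Prod.mk_zero_zero, ← Prod.mk_one_one, Set.Icc_prod_eq]
      refine (hΓ.comp (contDiff_snd.prodMk contDiff_fst).contDiffOn
        fun p hp => ⟨hp.2, hp.1⟩).congr fun p hp => ?_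
      rw [Set.IccExtend_of_mem _ _ hp.2, φ.extend_apply_of_mem_I hp.1]
      rfl)
  rw [curveIntegral_eq_zero_of_forall_eq _ (φ.evalAt 0) ?h0,
    curveIntegral_eq_zero_of_forall_eq _ (φ.evalAt 1) ?h1, add_zero, add_zero,
    curveIntegral_oneForm_slicePath, curveIntegral_oneForm_slicePath] at hmain
  case h0 => exact fun t => hΓ0 t t.2
  case h1 => exact fun t => hΓ1 t t.2
  exact hmain
end
end
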